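/- arXiv:1601.06973 — 4 statements merged into one kernel-verified Lean document; each statement's English description precedes it below -/
import Mathlib

section
/- Let V be a finite-dimensional real vector space. Given a subspace D ⊆ V and a skew-symmetric linear map π : V* → V, the set L = {(X + π(α), α) : X ∈ D, α ∈ D⁰} (where D⁰ ⊆ V* is the annihilator of D) is a maximally isotropic subspace of V ⊕ V* with L ∩ V = D. -/
open Module

variable {V : Type*} [AddCommGroup V] [Module ℝ V] [FiniteDimensional ℝ V]
variable {W : Type*} [AddCommGroup W] [Module ℝ W] [FiniteDimensional ℝ W]

/-- The canonical symmetric pairing on `V ⊕ V*`: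
`⟨(X,α),(Y,β)⟩₊ = (β(X) + α(Y))/2`. -/
noncomputable def pairPlus {V : Type*} [AddCommGroup V] [Module ℝ V]
    (p q : V × Module.Dual ℝ V) : ℝ := (q.2 p.1 + p.2 q.1) / 2

/-- A subspace of `V ⊕ V*` is isotropic if the pairing vanishes identically on it. -/
def IsIsotropic {V : Type*} [AddCommGroup V] [Module ℝ V]
    (L : Submodule ℝ (V × Module.Dual ℝ V)) : Prop :=
  ∀ p ∈ L, ∀ q ∈ L, pairPlus p q = 0

/-- Maximally isotropic: isotropic and of dimension `dim V`. -/
def IsMaxIsotropic {V : Type*} [AddCommGroup V] [Module ℝ V]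
    (L : Submodule ℝ (V × Module.Dual ℝ V)) : Prop :=
  IsIsotropic L ∧ Module.finrank ℝ L = Module.finrank ℝ V

/-- Backward image of `K ⊆ W ⊕ W*` under `φ : V → W`:
`B_φ(K) = {(X, φ*α) : (φ X, α) ∈ K}`. -/
def bimg {V W : Type*} [AddCommGroup V] [Module ℝ V] [AddCommGroup W] [Module ℝ W]
    (φ : V →ₗ[ℝ] W) (K : Submodule ℝ (W × Module.Dual ℝ W)) :
    Submodule ℝ (V × Module.Dual ℝ V) :=
  (K.comap (LinearMap.prodMap φ (LinearMap.id))).map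
    (LinearMap.prodMap LinearMap.id φ.dualMap)

/-- Forward image of `L ⊆ V ⊕ V*` under `φ : V → W`:
`F_φ(L) = {(φ X, α) : (X, φ*α) ∈ L}`. -/
def fimg {V W : Type*} [AddCommGroup V] [Module ℝ V] [AddCommGroup W] [Module ℝ W]
    (φ : V →ₗ[ℝ] W) (L : Submodule ℝ (V × Module.Dual ℝ V)) :
    Submodule ℝ (W × Module.Dual ℝ W) :=
  (L.comap (LinearMap.prodMap LinearMap.id φ.dualMap)).map
    (LinearMap.prodMap φ LinearMap.id)


/-- The subspace `L = {(X + π(α), α) : X ∈ D, α ∈ D⁰}` determined by a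
characteristic pair `(D, π)`. -/
def charPairL (D : Submodule ℝ V) (π : Module.Dual ℝ V →ₗ[ℝ] V) :
    Submodule ℝ (V × Module.Dual ℝ V) :=
  (D.prod D.dualAnnihilator).map
    (((LinearMap.fst ℝ V (Module.Dual ℝ V)) +
        π.comp (LinearMap.snd ℝ V (Module.Dual ℝ V))).prod
      (LinearMap.snd ℝ V (Module.Dual ℝ V)))

theorem mem_charPairL {E : Type*} [AddCommGroup E] [Module ℝ E]
    {D : Submodule ℝ E} {π : Module.Dual ℝ E →ₗ[ℝ] E}
    {p : E × Module.Dual ℝ E} :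
    p ∈ charPairL D π ↔ ∃ X ∈ D, ∃ α ∈ D.dualAnnihilator, (X + π α, α) = p := by
  simp only [charPairL, Submodule.mem_map, Submodule.mem_prod, Prod.exists]
  exact ⟨fun ⟨X, α, ⟨hX, hα⟩, h⟩ => ⟨X, hX, α, hα, h⟩,
    fun ⟨X, hX, α, hα, h⟩ => ⟨X, α, ⟨hX, hα⟩, h⟩⟩

theorem isIsotropic_charPairL {E : Type*} [AddCommGroup E] [Module ℝ E]
    (D : Submodule ℝ E) (π : Module.Dual ℝ E →ₗ[ℝ] E)
    (hskew : ∀ α β : Module.Dual ℝ E, β (π α) = - α (π β)) :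
    IsIsotropic (charPairL D π) := by
  intro p hp q hq
  obtain ⟨X, hX, α, hα, rfl⟩ := mem_charPairL.1 hp
  obtain ⟨Y, hY, β, hβ, rfl⟩ := mem_charPairL.1 hq
  have hβX : β X = 0 := (Submodule.mem_dualAnnihilator β).1 hβ X hX
  have hαY : α Y = 0 := (Submodule.mem_dualAnnihilator α).1 hα Y hY
  simp [pairPlus, hβX, hαY, hskew α β]

theorem finrank_submodule_prod {K M N : Type*} [DivisionRing K] [AddCommGroup M] [Module K M]
    [AddCommGroup N] [Module K N] (p : Submodule K M) (q : Submodule K N)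
    [FiniteDimensional K p] [FiniteDimensional K q] :
    finrank K (p.prod q) = finrank K p + finrank K q := by
  have e : p.prod q ≃ₗ[K] p × q :=
    { Equiv.Set.prod (p : Set M) (q : Set N) with
      map_add' := fun _ _ => rfl
      map_smul' := fun _ _ => rfl }
  rw [e.finrank_eq, finrank_prod]

theorem finrank_charPairL (D : Submodule ℝ V) (π : Module.Dual ℝ V →ₗ[ℝ] V) :
    finrank ℝ (charPairL D π) = finrank ℝ V := by
  have hinj : Function.Injective
      (((LinearMap.fst ℝ V (Module.Dual ℝ V)) +
          π.comp (LinearMap.snd ℝ V (Module.Dual ℝ V))).prod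
        (LinearMap.snd ℝ V (Module.Dual ℝ V))) := by
    rintro ⟨X, α⟩ ⟨Y, β⟩ h
    obtain ⟨h₁, rfl⟩ : X + π α = Y + π β ∧ α = β := Prod.ext_iff.1 h
    rw [add_right_cancel h₁]
  rw [charPairL, ← (Submodule.equivMapOfInjective _ hinj _).finrank_eq, finrank_submodule_prod,
    Subspace.finrank_add_finrank_dualAnnihilator_eq]

/-- a characteristic pair `(D, π)` with `π` skew determines a
maximally isotropic subspace `L` with `L ∩ V = D`. -/
theorem charPair_maxIsotropic (D : Submodule ℝ V) (π : Module.Dual ℝ V →ₗ[ℝ] V)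
    (hskew : ∀ α β : Module.Dual ℝ V, β (π α) = - α (π β)) :
    IsMaxIsotropic (charPairL D π) ∧
      ∀ X : V, (X, (0 : Module.Dual ℝ V)) ∈ charPairL D π ↔ X ∈ D := by
  refine ⟨⟨isIsotropic_charPairL D π hskew, finrank_charPairL D π⟩, fun X => ?_⟩
  rw [mem_charPairL]
  constructor
  · rintro ⟨Y, hY, α, -, h⟩
    obtain ⟨rfl, rfl⟩ := Prod.mk.inj h
    simpa using hY
  · exact fun hX => ⟨X, hX, 0, zero_mem _, by simp⟩
end

section
/- Let φ : V → W be a linear map between finite-dimensional real vector spaces and K ⊆ W ⊕ W* a maximally isotropic subspace. Then the backward image B_φ(K) = {(X, φ*α) : X ∈ V, α ∈ W*, (φ(X), α) ∈ K} is a maximally isotropic subspace of V ⊕ V*. -/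
open Module

variable {V : Type*} [AddCommGroup V] [Module ℝ V] [FiniteDimensional ℝ V]
variable {W : Type*} [AddCommGroup W] [Module ℝ W] [FiniteDimensional ℝ W]

theorem Submodule.finrank_map_add_finrank_inf_ker {k E F : Type*} [Field k] [AddCommGroup E]
    [Module k E] [FiniteDimensional k E] [AddCommGroup F] [Module k F]
    (f : E →ₗ[k] F) (A : Submodule k E) :
    finrank k (A.map f) + finrank k (A ⊓ LinearMap.ker f : Submodule k E) = finrank k A := by
  rw [← LinearMap.finrank_range_add_finrank_ker (f.domRestrict A), LinearMap.range_domRestrict,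
    LinearMap.ker_domRestrict, ← Submodule.finrank_map_subtype_eq A,
    ← Submodule.map_comap_subtype]

theorem Submodule.finrank_map_of_injective {k E F : Type*} [Field k] [AddCommGroup E]
    [Module k E] [AddCommGroup F] [Module k F] {f : E →ₗ[k] F}
    (hf : Function.Injective f) (A : Submodule k E) : finrank k (A.map f) = finrank k A :=
  (Submodule.equivMapOfInjective f hf A).finrank_eq.symm

/-- The pairing `pairPlus` as a bilinear form. -/
noncomputable def pairPlusForm (W : Type*) [AddCommGroup W] [Module ℝ W] :
    LinearMap.BilinForm ℝ (W × Module.Dual ℝ W) :=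
  LinearMap.mk₂ ℝ pairPlus
    (fun _ _ _ => by simp [pairPlus]; ring) (fun _ _ _ => by simp [pairPlus]; ring)
    (fun _ _ _ => by simp [pairPlus]; ring) (fun _ _ _ => by simp [pairPlus]; ring)

@[simp]
theorem pairPlusForm_apply {W : Type*} [AddCommGroup W] [Module ℝ W]
    (p q : W × Module.Dual ℝ W) : pairPlusForm W p q = pairPlus p q := rfl

theorem pairPlus_comm {W : Type*} [AddCommGroup W] [Module ℝ W]
    (p q : W × Module.Dual ℝ W) : pairPlus p q = pairPlus q p := by
  simp [pairPlus, add_comm]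

theorem pairPlusForm_nondegenerate {W : Type*} [AddCommGroup W] [Module ℝ W] :
    (pairPlusForm W).Nondegenerate := by
  have eq_zero (p : W × Module.Dual ℝ W) (h : ∀ q, pairPlus p q = 0) : p = 0 := by
    refine Prod.ext ((Module.forall_dual_apply_eq_zero_iff ℝ p.1).1 fun β => ?_)
      (LinearMap.ext fun Y => ?_)
    · simpa [pairPlus] using h (0, β)
    · simpa [pairPlus] using h (Y, 0)
  exact ⟨eq_zero, fun q h => eq_zero q fun p => (pairPlus_comm q p).trans (h p)⟩

theorem IsMaxIsotropic.orthogonal_eq {K : Submodule ℝ (W × Module.Dual ℝ W)}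
    (hK : IsMaxIsotropic K) : (pairPlusForm W).orthogonal K = K := by
  have le_orthogonal : K ≤ (pairPlusForm W).orthogonal K := fun q hq p hp => hK.1 p hp q hq
  refine (Submodule.eq_of_le_of_finrank_le le_orthogonal ?_).symm
  rw [LinearMap.BilinForm.finrank_orthogonal pairPlusForm_nondegenerate, hK.2,
    finrank_prod, Subspace.dual_finrank_eq]
  omega

theorem orthogonal_bot_prod_dualAnnihilator {W : Type*} [AddCommGroup W] [Module ℝ W]
    (R : Submodule ℝ W) :
    (pairPlusForm W).orthogonal ((⊥ : Submodule ℝ W).prod R.dualAnnihilator) = R.prod ⊤ := by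
  ext ⟨w, β⟩
  rw [LinearMap.BilinForm.mem_orthogonal_iff]
  simp only [Submodule.mem_prod, Submodule.mem_top, and_true]
  rw [← Subspace.forall_mem_dualAnnihilator_apply_eq_zero_iff]
  constructor
  · intro h α hα
    simpa [pairPlus] using h (0, α) (by simpa using hα)
  · rintro h ⟨X, α⟩ ⟨hX, hα⟩
    obtain rfl : X = 0 := hX
    simpa [pairPlus] using h α hα

theorem IsMaxIsotropic.finrank_inf_prod_top {K : Submodule ℝ (W × Module.Dual ℝ W)}
    (hK : IsMaxIsotropic K) (R : Submodule ℝ W) :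
    finrank ℝ (K ⊓ R.prod ⊤ : Submodule ℝ (W × Module.Dual ℝ W)) =
      finrank ℝ R + finrank ℝ (K ⊓ (⊥ : Submodule ℝ W).prod R.dualAnnihilator :
        Submodule ℝ (W × Module.Dual ℝ W)) := by
  set N := (⊥ : Submodule ℝ W).prod R.dualAnnihilator with hN
  have orthogonal_sup : (pairPlusForm W).orthogonal (K ⊔ N) = K ⊓ R.prod ⊤ := by
    rw [← orthogonal_bot_prod_dualAnnihilator R, ← hN]
    nth_rewrite 2 [← hK.orthogonal_eq]
    refine le_antisymm (le_inf (LinearMap.BilinForm.orthogonal_le le_sup_left)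
      (LinearMap.BilinForm.orthogonal_le le_sup_right)) ?_
    rintro q ⟨hqK, hqN⟩ p hp
    obtain ⟨x, hx, y, hy, rfl⟩ := Submodule.mem_sup.1 hp
    rw [map_add, LinearMap.add_apply, hqK x hx, hqN y hy, add_zero]
  have finrank_N : finrank ℝ N = finrank ℝ R.dualAnnihilator := by
    rw [hN, ← Submodule.map_inr]
    exact Submodule.finrank_map_of_injective LinearMap.inr_injective _
  have h₁ := LinearMap.BilinForm.finrank_orthogonal (pairPlusForm_nondegenerate (W := W)) (K ⊔ N)
  have h₂ := Submodule.finrank_sup_add_finrank_inf_eq K N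
  have h₃ := Subspace.finrank_add_finrank_dualAnnihilator_eq R
  have h₄ := Submodule.finrank_le (K ⊔ N)
  rw [finrank_prod, Subspace.dual_finrank_eq] at h₁ h₄
  rw [orthogonal_sup] at h₁
  have := hK.2
  omega

theorem IsIsotropic.bimg {V W : Type*} [AddCommGroup V] [Module ℝ V] [AddCommGroup W]
    [Module ℝ W] {K : Submodule ℝ (W × Module.Dual ℝ W)} (hK : IsIsotropic K)
    (φ : V →ₗ[ℝ] W) : IsIsotropic (bimg φ K) := by
  rintro _ ⟨p, hp, rfl⟩ _ ⟨q, hq, rfl⟩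
  exact hK _ hp _ hq

/-- the backward image of a maximally isotropic subspace is
maximally isotropic. -/
theorem bimg_maxIsotropic (φ : V →ₗ[ℝ] W) (K : Submodule ℝ (W × Module.Dual ℝ W))
    (hK : IsMaxIsotropic K) : IsMaxIsotropic (bimg φ K) := by
  refine ⟨hK.1.bimg φ, ?_⟩
  set A := K.comap (LinearMap.prodMap φ LinearMap.id) with hA
  have finrank_bimg := Submodule.finrank_map_add_finrank_inf_ker
    (LinearMap.prodMap LinearMap.id φ.dualMap) A
  have finrank_A := Submodule.finrank_map_add_finrank_inf_ker
    (LinearMap.prodMap φ LinearMap.id) A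
  have map_A : A.map (LinearMap.prodMap φ LinearMap.id) = K ⊓ (LinearMap.range φ).prod ⊤ := by
    rw [hA, Submodule.map_comap_eq, LinearMap.range_prodMap, LinearMap.range_id, inf_comm]
  have A_inf_ker : A ⊓ LinearMap.ker (LinearMap.prodMap φ LinearMap.id) =
      (LinearMap.ker φ).map (LinearMap.inl ℝ V (Module.Dual ℝ W)) := by
    rw [Submodule.map_inl, LinearMap.ker_prodMap, LinearMap.ker_id, inf_eq_right,
      ← LinearMap.ker_id, ← LinearMap.ker_prodMap]
    exact Submodule.comap_mono bot_le
  have A_inf_ker_dualMap : A ⊓ LinearMap.ker (LinearMap.prodMap LinearMap.id φ.dualMap) =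
      (K.comap (LinearMap.inr ℝ W _) ⊓ (LinearMap.range φ).dualAnnihilator).map
        (LinearMap.inr ℝ V _) := by
    rw [← LinearMap.ker_dualMap_eq_dualAnnihilator_range]
    ext ⟨X, α⟩
    simp only [hA, Submodule.mem_inf, Submodule.mem_comap, Submodule.map_inr, Submodule.mem_prod,
      Submodule.mem_bot, LinearMap.ker_prodMap, LinearMap.ker_id, LinearMap.prodMap_apply,
      LinearMap.id_apply, LinearMap.inr_apply]
    constructor
    · rintro ⟨h, rfl, hα⟩
      exact ⟨rfl, by simpa using h, hα⟩
    · rintro ⟨rfl, h, hα⟩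
      exact ⟨by simpa using h, rfl, hα⟩
  have K_inf : K ⊓ (⊥ : Submodule ℝ W).prod (LinearMap.range φ).dualAnnihilator =
      (K.comap (LinearMap.inr ℝ W _) ⊓ (LinearMap.range φ).dualAnnihilator).map
        (LinearMap.inr ℝ W _) := by
    rw [← Submodule.map_inr, inf_comm, inf_comm (K.comap _), Submodule.map_inf_eq_map_inf_comap]
  have finrank_K_inf := hK.finrank_inf_prod_top (LinearMap.range φ)
  rw [K_inf, Submodule.finrank_map_of_injective LinearMap.inr_injective] at finrank_K_inf
  rw [A_inf_ker_dualMap,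
    Submodule.finrank_map_of_injective (f := LinearMap.inr ℝ V (Module.Dual ℝ W))
      LinearMap.inr_injective] at finrank_bimg
  rw [map_A, A_inf_ker, Submodule.finrank_map_of_injective LinearMap.inl_injective] at finrank_A
  have := LinearMap.finrank_range_add_finrank_ker φ
  change finrank ℝ (A.map (LinearMap.prodMap LinearMap.id φ.dualMap)) = _
  omega
end

section
/- Let φ : V → W be a surjective linear map, K ⊆ W ⊕ W* maximally isotropic, and let L = B_φ(K) be the backward image. Then F_φ(L) = K; i.e., a surjection that is a backward Dirac map (pointwise) is also a forward Dirac map. -/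
open Module

variable {V : Type*} [AddCommGroup V] [Module ℝ V] [FiniteDimensional ℝ V]
variable {W : Type*} [AddCommGroup W] [Module ℝ W] [FiniteDimensional ℝ W]

/-- for a surjection, the forward image of the backward image
recovers `K`. -/
theorem fimg_bimg_of_surjective (φ : V →ₗ[ℝ] W) (hφ : Function.Surjective φ)
    (K : Submodule ℝ (W × Module.Dual ℝ W)) (hK : IsMaxIsotropic K)
    (L : Submodule ℝ (V × Module.Dual ℝ V)) (hLK : L = bimg φ K) :
    fimg φ L = K := by
  have hinj : Function.Injective
      (LinearMap.prodMap (LinearMap.id : V →ₗ[ℝ] V) φ.dualMap) :=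
    Function.injective_id.prodMap (LinearMap.dualMap_injective_of_surjective hφ)
  have hsurj : Function.Surjective
      (LinearMap.prodMap φ (LinearMap.id : Dual ℝ W →ₗ[ℝ] Dual ℝ W)) :=
    hφ.prodMap Function.surjective_id
  rw [hLK, fimg, bimg, Submodule.comap_map_eq_of_injective hinj,
    Submodule.map_comap_eq_of_surjective hsurj]
end

section
/- Let φ : V → W be an injective linear map, L ⊆ V ⊕ V* maximally isotropic, and K ⊆ W ⊕ W* maximally isotropic with K = F_φ(L). Then L = B_φ(K); i.e., an injective forward Dirac map is also a backward Dirac map (pointwise). -/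
open Module

variable {V : Type*} [AddCommGroup V] [Module ℝ V] [FiniteDimensional ℝ V]
variable {W : Type*} [AddCommGroup W] [Module ℝ W] [FiniteDimensional ℝ W]

/-- an injective forward Dirac map is also backward Dirac. -/
theorem bimg_fimg_of_injective (φ : V →ₗ[ℝ] W) (hφ : Function.Injective φ)
    (L : Submodule ℝ (V × Module.Dual ℝ V)) (hL : IsMaxIsotropic L)
    (K : Submodule ℝ (W × Module.Dual ℝ W)) (hK : IsMaxIsotropic K)
    (hKL : K = fimg φ L) :
    L = bimg φ K := by
  subst hKL
  ext ⟨X, β⟩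
  constructor
  · intro h
    obtain ⟨α, rfl⟩ := LinearMap.dualMap_surjective_of_injective hφ β
    exact ⟨(X, α), ⟨(X, α), h, rfl⟩, rfl⟩
  · rintro ⟨⟨X', α⟩, ⟨⟨Y, γ⟩, hY, hYX⟩, hX⟩
    obtain ⟨hYX', rfl⟩ := Prod.mk.inj hYX
    obtain rfl := hφ hYX'
    exact hX ▸ hY
end
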